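/- For every integer i ≥ 1, the rational number b_{(i,2,1)} equals i/(2(i+1)(i+2)). -/

import Mathlib

open Finset

/-- `b i j k` from the paper, defined for `i ≥ 1` (we set `b 0 _ _ = 0`):
`b 1 j 0 = -1/j!`, `b 1 j k = (-1)^(j+1-k) * B_(j+1-k) / (j+1-k)!` for `k ≥ 1`, and for `i ≥ 2`,
`b i j k = ∑_{m=0}^{min(j, i+j-k)} ((-1)^m B_m / m!) * b (i-1) (j+1-m) k - (if k = 0 then 1/j! else 0)`.
Here `bernoulli` is Mathlib's Bernoulli number, with EGF `t/(e^t - 1)` (so `bernoulli 1 = -1/2`). -/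
def b : ℕ → ℕ → ℕ → ℚ
  | 0, _, _ => 0
  | 1, j, k =>
      if k = 0 then -(1 / (Nat.factorial j : ℚ))
      else (-1) ^ (j + 1 - k) * bernoulli (j + 1 - k) / (Nat.factorial (j + 1 - k) : ℚ)
  | (i + 2), j, k =>
      (∑ m ∈ Finset.range (min j (i + 2 + j - k) + 1),
        ((-1) ^ m * bernoulli m / (Nat.factorial m : ℚ)) * b (i + 1) (j + 1 - m) k)
      - (if k = 0 then 1 / (Nat.factorial j : ℚ) else 0)

open PowerSeries in
/-- The power series `1 - e^(-t)`. -/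
noncomputable def oneSubExpNeg : PowerSeries ℚ := 1 - evalNegHom (exp ℚ)

open PowerSeries in
theorem coeff_oneSubExpNeg (n : ℕ) :
    coeff n oneSubExpNeg = (if n = 0 then 1 else 0) - (-1) ^ n / (n.factorial : ℚ) := by
  simp [oneSubExpNeg, evalNegHom, coeff_rescale, coeff_exp, coeff_one, div_eq_mul_inv]

open PowerSeries in
theorem bernoulli'PowerSeries_mul_oneSubExpNeg :
    bernoulli'PowerSeries ℚ * oneSubExpNeg = X := by
  have h1 := bernoulli'PowerSeries_mul_exp_sub_one ℚ
  have h2 := exp_mul_exp_neg_eq_one (A := ℚ)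
  unfold oneSubExpNeg
  linear_combination (evalNegHom (exp ℚ)) * h1 + (X - bernoulli'PowerSeries ℚ) * h2

open PowerSeries in
theorem X_dvd_oneSubExpNeg : X ∣ oneSubExpNeg := by
  rw [X_dvd_iff, ← coeff_zero_eq_constantCoeff_apply, coeff_oneSubExpNeg]
  simp

open PowerSeries in
theorem derivative_oneSubExpNeg : d⁄dX ℚ oneSubExpNeg = 1 - oneSubExpNeg := by
  ext n
  rw [coeff_derivative, map_sub, coeff_oneSubExpNeg, coeff_oneSubExpNeg, coeff_one,
    Nat.factorial_succ]
  have := Nat.factorial_ne_zero n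
  push_cast
  field_simp
  ring

open PowerSeries in
/-- The truncation `∑_{n=1}^N (1 - e^(-t))^n / (n + i)`. -/
noncomputable def shiftedLogSum (i N : ℕ) : PowerSeries ℚ :=
  ∑ n ∈ range N, C (1 / ((n : ℚ) + 1 + i)) * oneSubExpNeg ^ (n + 1)

open PowerSeries in
theorem coeff_zero_shiftedLogSum (i N : ℕ) : coeff 0 (shiftedLogSum i N) = 0 := by
  have h : constantCoeff oneSubExpNeg = 0 := X_dvd_iff.mp X_dvd_oneSubExpNeg
  simp [shiftedLogSum, h]

open PowerSeries in
theorem derivative_shiftedLogSum_zero (N : ℕ) :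
    d⁄dX ℚ (shiftedLogSum 0 N) = 1 - oneSubExpNeg ^ N := by
  induction N with
  | zero => simp [shiftedLogSum]
  | succ N ih =>
    have hC : (C (1 / ((N : ℚ) + 1)) : PowerSeries ℚ) * ((N : PowerSeries ℚ) + 1) = 1 := by
      rw [← map_natCast (C (R := ℚ)), ← map_one (C (R := ℚ)), ← map_add, ← map_mul]
      congr 1
      field_simp
    rw [shiftedLogSum, sum_range_succ, ← shiftedLogSum, map_add, ih, Derivation.leibniz,
      Derivation.leibniz_pow, derivative_oneSubExpNeg, derivative_C]
    simp only [smul_eq_mul, nsmul_eq_mul, Nat.cast_add, Nat.cast_one, Nat.cast_zero, add_zero,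
      add_tsub_cancel_right, mul_zero]
    linear_combination oneSubExpNeg ^ N * (1 - oneSubExpNeg) * hC

open PowerSeries in
theorem coeff_shiftedLogSum_zero {j N : ℕ} (hj : 1 ≤ j) (hN : j ≤ N) :
    coeff j (shiftedLogSum 0 N) = if j = 1 then 1 else 0 := by
  obtain ⟨k, rfl⟩ := Nat.exists_eq_add_of_le' hj
  have h := congrArg (coeff k) (derivative_shiftedLogSum_zero N)
  have h0 : coeff k (oneSubExpNeg ^ N) = 0 :=
    X_pow_dvd_iff.mp (pow_dvd_pow_of_dvd X_dvd_oneSubExpNeg N) k (by omega)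
  rw [coeff_derivative, map_sub, h0, coeff_one] at h
  have hk : (k : ℚ) + 1 ≠ 0 := by positivity
  rcases Nat.eq_zero_or_pos k with rfl | hk0
  · simpa using h
  · simpa [hk0.ne', hk] using h

open PowerSeries in
theorem bernoulli'PowerSeries_mul_shiftedLogSum (i N : ℕ) :
    bernoulli'PowerSeries ℚ * shiftedLogSum i (N + 1) =
      (C (1 / ((i : ℚ) + 1)) + shiftedLogSum (i + 1) N) * X := by
  have h (n : ℕ) (c : PowerSeries ℚ) : bernoulli'PowerSeries ℚ * (c * oneSubExpNeg ^ (n + 1)) =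
      c * oneSubExpNeg ^ n * X := by
    rw [← bernoulli'PowerSeries_mul_oneSubExpNeg]
    ring
  rw [shiftedLogSum, mul_sum, sum_congr rfl fun n _ => h n _, ← sum_mul, sum_range_succ',
    add_comm, shiftedLogSum]
  congr 2
  · simp [add_comm]
  · refine sum_congr rfl fun n _ => ?_
    push_cast
    ring_nf

open PowerSeries in
theorem sum_bernoulli_mul_eq_coeff_shiftedLogSum {f : ℕ → ℚ} {i j N : ℕ} (hj : 1 ≤ j)
    (hN : j ≤ N) (hf : ∀ k, 1 ≤ k → k ≤ N + 1 → f k = coeff k (shiftedLogSum i (N + 1))) :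
    ∑ m ∈ range (j + 1), ((-1) ^ m * bernoulli m / (m.factorial : ℚ)) * f (j + 1 - m) =
      coeff j (shiftedLogSum (i + 1) N) := by
  have h := congrArg (coeff (j + 1)) (bernoulli'PowerSeries_mul_shiftedLogSum i N)
  rw [coeff_succ_mul_X, map_add, coeff_C, if_neg (by omega), zero_add, coeff_mul,
    Nat.sum_antidiagonal_eq_sum_range_succ
      (fun a c => coeff a (bernoulli'PowerSeries ℚ) * coeff c (shiftedLogSum i (N + 1))),
    sum_range_succ, Nat.sub_self, coeff_zero_shiftedLogSum, mul_zero, add_zero] at h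
  rw [← h]
  refine sum_congr rfl fun m hm => ?_
  have hm' := mem_range.mp hm
  rw [hf _ (by omega) (by omega)]
  congr 1
  rw [bernoulli'PowerSeries, coeff_mk, bernoulli, ← mul_assoc, ← mul_pow]
  simp

open PowerSeries in
theorem b_one_eq_coeff_shiftedLogSum (i : ℕ) {j N : ℕ} (hj : 1 ≤ j) (hN : j ≤ N) :
    b (i + 1) j 1 = coeff j (shiftedLogSum (i + 1) N) := by
  induction i generalizing j N with
  | zero =>
    rw [← sum_bernoulli_mul_eq_coeff_shiftedLogSum hj hN fun k h1 h2 =>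
      (coeff_shiftedLogSum_zero h1 h2).symm, sum_range_succ, sum_eq_zero]
    · simp [b]
    · intro m hm
      have := mem_range.mp hm
      rw [if_neg (by omega), mul_zero]
  | succ i ih =>
    rw [← sum_bernoulli_mul_eq_coeff_shiftedLogSum hj hN fun k h1 h2 => ih h1 h2, b,
      if_neg one_ne_zero, sub_zero, min_eq_left (by omega)]

/-- For every integer `i ≥ 1`, `b i 2 1 = i/(2(i+1)(i+2))`. -/
theorem b_two_one (i : ℕ) (hi : 1 ≤ i) :
    b i 2 1 = (i : ℚ) / (2 * ((i : ℚ) + 1) * ((i : ℚ) + 2)) := by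
  obtain ⟨k, rfl⟩ := Nat.exists_eq_add_of_le' hi
  rw [b_one_eq_coeff_shiftedLogSum k (j := 2) (N := 2) (by lia) le_rfl, shiftedLogSum]
  have h : PowerSeries.coeff 2 (oneSubExpNeg ^ 2) = 1 := by
    rw [pow_two, PowerSeries.coeff_mul, Nat.sum_antidiagonal_eq_sum_range_succ_mk]
    simp [sum_range_succ, coeff_oneSubExpNeg]
  rw [sum_range_succ, sum_range_one, map_add, PowerSeries.coeff_C_mul, PowerSeries.coeff_C_mul,
    zero_add, pow_one, one_add_one_eq_two, h, coeff_oneSubExpNeg]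
  push_cast
  norm_num
  field_simp
  ring
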